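/- Let S = (ℤ/2)[y2, y3, y12, y16, y20] be the polynomial ring over the field with two elements in five variables, and let J ⊆ S be the ideal generated by the twelve elements: y3^3; y16·y2 + y12·y3^2 + y2^6·y3^2; y16·y3; y12^2·y2 + y12·y2^4·y3^2 + y20·y3^2; y12^2·y3; y12·y16 + y2^14 + y12·y2^5·y3^2 + y2^11·y3^2; y12^3 + y16·y20 + y2^5·y20·y3^2; y12^2·y16 + y20^2 + y12·y2^11·y3^2; y12^2·y20 + y12·y2^13·y3^2 + y12·y2^3·y20·y3^2; y12·y16^2 + y12·y2^13·y3^2; y16^3 + y12·y16·y20 + y12·y2^5·y20·y3^2; y16^2·y20 + y2^13·y20·y3^2. Then y12^4·y16 + y2^2·y20^3 ∈ J, i.e. y12^4·y16 and y2^2·y20^3 have the same image in S/J. -/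

import Mathlib

open MvPolynomial

/-- `y2`, the degree-2 generator of the mod 2 cohomology ring of EVI. -/
noncomputable def y2 : MvPolynomial (Fin 5) (ZMod 2) := X 0

/-- `y3`, the degree-3 generator of the mod 2 cohomology ring of EVI. -/
noncomputable def y3 : MvPolynomial (Fin 5) (ZMod 2) := X 1

/-- `y12`, the degree-12 generator of the mod 2 cohomology ring of EVI. -/
noncomputable def y12 : MvPolynomial (Fin 5) (ZMod 2) := X 2

/-- `y16`, the degree-16 generator of the mod 2 cohomology ring of EVI. -/
noncomputable def y16 : MvPolynomial (Fin 5) (ZMod 2) := X 3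

/-- `y20`, the degree-20 generator of the mod 2 cohomology ring of EVI. -/
noncomputable def y20 : MvPolynomial (Fin 5) (ZMod 2) := X 4

/-- The ideal of the twelve relations in the mod 2 cohomology ring of EVI (Nakagawa). -/
noncomputable def J : Ideal (MvPolynomial (Fin 5) (ZMod 2)) :=
  Ideal.span
    { y3 ^ 3,
      y16 * y2 + y12 * y3 ^ 2 + y2 ^ 6 * y3 ^ 2,
      y16 * y3,
      y12 ^ 2 * y2 + y12 * y2 ^ 4 * y3 ^ 2 + y20 * y3 ^ 2,
      y12 ^ 2 * y3,
      y12 * y16 + y2 ^ 14 + y12 * y2 ^ 5 * y3 ^ 2 + y2 ^ 11 * y3 ^ 2,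
      y12 ^ 3 + y16 * y20 + y2 ^ 5 * y20 * y3 ^ 2,
      y12 ^ 2 * y16 + y20 ^ 2 + y12 * y2 ^ 11 * y3 ^ 2,
      y12 ^ 2 * y20 + y12 * y2 ^ 13 * y3 ^ 2 + y12 * y2 ^ 3 * y20 * y3 ^ 2,
      y12 * y16 ^ 2 + y12 * y2 ^ 13 * y3 ^ 2,
      y16 ^ 3 + y12 * y16 * y20 + y12 * y2 ^ 5 * y20 * y3 ^ 2,
      y16 ^ 2 * y20 + y2 ^ 13 * y20 * y3 ^ 2 }

theorem stmt_15 : y12 ^ 4 * y16 + y2 ^ 2 * y20 ^ 3 ∈ J := by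
  have h2 : y16 * y3 ∈ J := Ideal.subset_span (by simp)
  have h3 : y12 ^ 2 * y2 + y12 * y2 ^ 4 * y3 ^ 2 + y20 * y3 ^ 2 ∈ J :=
    Ideal.subset_span (by simp)
  have h6 : y12 ^ 3 + y16 * y20 + y2 ^ 5 * y20 * y3 ^ 2 ∈ J := Ideal.subset_span (by simp)
  have h7 : y12 ^ 2 * y16 + y20 ^ 2 + y12 * y2 ^ 11 * y3 ^ 2 ∈ J :=
    Ideal.subset_span (by simp)
  have h9 : y12 * y16 ^ 2 + y12 * y2 ^ 13 * y3 ^ 2 ∈ J := Ideal.subset_span (by simp)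
  have two : (2 : MvPolynomial (Fin 5) (ZMod 2)) = 0 := CharTwo.two_eq_zero
  have key := J.add_mem (J.add_mem (J.add_mem (J.add_mem
    (J.mul_mem_left (y2 * y3 * y20 ^ 2) h2)
    (J.mul_mem_left (y2 * y16 * y20) h3))
    (J.mul_mem_left (y12 * y16) h6))
    (J.mul_mem_left (y2 ^ 2 * y20) h7))
    (J.mul_mem_left y20 h9)
  convert key using 1
  linear_combination (-(y2 * y3 ^ 2 * y16 * y20 ^ 2 + y2 ^ 2 * y12 ^ 2 * y16 * y20
    + y12 * y2 ^ 5 * y3 ^ 2 * y16 * y20 + y12 * y16 ^ 2 * y20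
    + y12 * y2 ^ 13 * y3 ^ 2 * y20)) * two
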